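/- Let G be a finite group whose order is squarefree (a product of distinct primes). Then ℂ[G] is of Knutson type: every irreducible complex character χ of G admits a virtual character φ with χ·φ = ρ_reg. -/

import Mathlib

open scoped ComplexOrder

noncomputable section

/-- `χ : G → ℂ` is an irreducible character: the character of a simple
finite-dimensional complex representation of `G`. -/
def IsIrrChar (G : Type) [Group G] (χ : G → ℂ) : Prop :=
  ∃ V : FDRep ℂ G, CategoryTheory.Simple V ∧ χ = V.character

/-- A virtual character is a `ℤ`-linear combination of irreducible characters. -/
def IsVirtualChar (G : Type) [Group G] (χ : G → ℂ) : Prop :=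
  χ ∈ Submodule.span ℤ {f : G → ℂ | IsIrrChar G f}

open Classical in
/-- The regular character: `|G|` at the identity, `0` elsewhere. -/
def regChar (G : Type) [Group G] : G → ℂ :=
  fun g => if g = 1 then (Nat.card G : ℂ) else 0

/-- The Knutson index of `χ`: the least positive `n` such that `χ·φ = n·ρ_reg`
for some virtual character `φ`. -/
def KnutsonIndex (G : Type) [Group G] (χ : G → ℂ) : ℕ :=
  sInf {n : ℕ | 0 < n ∧ ∃ φ : G → ℂ, IsVirtualChar G φ ∧ χ * φ = n • regChar G}

/-- `ℂ[G]` is of Knutson type: every irreducible character is regular invertible. -/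
def IsKnutsonType (G : Type) [Group G] : Prop :=
  ∀ χ : G → ℂ, IsIrrChar G χ → ∃ φ : G → ℂ, IsVirtualChar G φ ∧ χ * φ = regChar G

/-- Savitskii's preorder: `φ ≤ χ` iff `φ(1) ≤ χ(1)` and every zero of `χ` is a zero of `φ`. -/
def SavitskiiLE (G : Type) [Group G] (φ χ : G → ℂ) : Prop :=
  φ 1 ≤ χ 1 ∧ ∀ g : G, χ g = 0 → φ g = 0

/-- A virtual character of positive degree is Savitskii-minimal if every virtual
character of positive degree below it is also above it. -/
def SavitskiiMinimal (G : Type) [Group G] (χ : G → ℂ) : Prop :=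
  ∀ φ : G → ℂ, IsVirtualChar G φ → 0 < φ 1 → SavitskiiLE G φ χ → SavitskiiLE G χ φ

end

open Representation

theorem trace_eq_zero_of_basis_permuted {k V ι : Type*} [Field k] [AddCommGroup V] [Module k V]
    [Finite ι] (b : Module.Basis ι k V) (f : V →ₗ[k] V) (σ : ι → ι) (hσ : ∀ i, σ i ≠ i)
    (hf : ∀ i, f (b i) = b (σ i)) : LinearMap.trace k V f = 0 := by
  classical
  have := Fintype.ofFinite ι
  rw [LinearMap.trace_eq_matrix_trace k b, Matrix.trace]
  refine Finset.sum_eq_zero fun i _ => ?_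
  rw [Matrix.diag_apply, LinearMap.toMatrix_apply, hf, Module.Basis.repr_self,
    Finsupp.single_eq_of_ne (hσ i).symm]

theorem character_eq_add_of_isCompl {k G V : Type*} [Field k] [Group G] [AddCommGroup V]
    [Module k V] [FiniteDimensional k V] {ρ : Representation k G V} {W W' : Subrepresentation ρ}
    (h : IsCompl W W') :
    ρ.character = W.toRepresentation.character + W'.toRepresentation.character := by
  have hc : IsCompl W.toSubmodule W'.toSubmodule := by
    rw [isCompl_iff, disjoint_iff, codisjoint_iff] at h ⊢
    rw [← Subrepresentation.toSubmodule_inf, ← Subrepresentation.toSubmodule_sup, h.1, h.2]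
    exact ⟨rfl, rfl⟩
  ext g
  have key : ρ g = (Submodule.prodEquivOfIsCompl _ _ hc).conj
      ((W.toRepresentation g).prodMap (W'.toRepresentation g)) := by
    ext v
    obtain ⟨w, rfl⟩ := (Submodule.prodEquivOfIsCompl _ _ hc).surjective v
    simp [LinearEquiv.conj_apply, Subrepresentation.toRepresentation]
  rw [Pi.add_apply, Representation.character, key, LinearMap.trace_conj',
    LinearMap.trace_prodMap']
  rfl

theorem IsIrrChar.of_isIrreducible {G V : Type} [Group G] [Finite G] [AddCommGroup V]
    [Module ℂ V] [FiniteDimensional ℂ V] (ρ : Representation ℂ G V) [IsIrreducible ρ] :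
    IsIrrChar G ρ.character := by
  classical
  have := Fintype.ofFinite G
  have hne : (Nat.card G : ℂ) ≠ 0 := Nat.cast_ne_zero.2 Nat.card_pos.ne'
  have := invertibleOfNonzero hne
  refine ⟨FDRep.of ρ, ?_, rfl⟩
  rw [FDRep.simple_iff_char_is_norm_one]
  have := char_orthonormal ρ ρ
  rw [if_pos ⟨Representation.Equiv.refl ρ⟩, inv_mul_eq_one₀ hne] at this
  exact this.symm

theorem one_le_finrank_intertwiningMap_self {k G V : Type*} [Field k] [Group G] [AddCommGroup V]
    [Module k V] [FiniteDimensional k V] [Nontrivial V] (ρ : Representation k G V) :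
    1 ≤ Module.finrank k (IntertwiningMap ρ ρ) := by
  have : Nontrivial (IntertwiningMap ρ ρ) := by
    obtain ⟨v, hv⟩ := exists_ne (0 : V)
    exact ⟨IntertwiningMap.id ρ, 0, fun h => hv (DFunLike.congr_fun h v)⟩
  have : FiniteDimensional k (IntertwiningMap ρ ρ) :=
    Module.Finite.equiv (invariantsEquivIntertwiningMap ρ ρ)
  exact Module.finrank_pos

theorem Subrepresentation.nontrivial_of_ne_bot {k G V : Type*} [Field k] [Group G]
    [AddCommGroup V] [Module k V] {ρ : Representation k G V} {W : Subrepresentation ρ}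
    (h : W ≠ ⊥) : Nontrivial W.toSubmodule :=
  (Submodule.nontrivial_iff_ne_bot).2 fun h' => h (Subrepresentation.toSubmodule_injective h')

theorem isIrreducible_of_char_norm_eq_one {G V : Type*} [Group G] [Fintype G] [AddCommGroup V]
    [Module ℂ V] [FiniteDimensional ℂ V] (ρ : Representation ℂ G V)
    (hρ : (Nat.card G : ℂ)⁻¹ * ∑ g, ρ.character g * ρ.character g⁻¹ = 1) : IsIrreducible ρ := by
  have hne : (Nat.card G : ℂ) ≠ 0 := Nat.cast_ne_zero.2 Nat.card_pos.ne'
  have := invertibleOfNonzero hne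
  have : NeZero (Nat.card G : ℂ) := ⟨hne⟩
  have hnt : Nontrivial V := by
    by_contra hs
    rw [not_nontrivial_iff_subsingleton] at hs
    have h0 : ∀ g, ρ.character g = 0 := fun g => by
      rw [Representation.character, Subsingleton.elim (ρ g) 0, map_zero]
    simp [h0] at hρ
  have : Nontrivial (Subrepresentation ρ) :=
    ⟨⊥, ⊤, fun h => bot_ne_top (congrArg Subrepresentation.toSubmodule h)⟩
  refine ⟨fun W => ?_⟩
  by_contra! hW
  obtain ⟨W', hc⟩ := exists_isCompl W
  have := Subrepresentation.nontrivial_of_ne_bot hW.1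
  have := Subrepresentation.nontrivial_of_ne_bot (W := W')
    fun h => hW.2 (by simpa [h] using hc.codisjoint)
  have h1 := one_le_finrank_intertwiningMap_self W.toRepresentation
  have h2 := one_le_finrank_intertwiningMap_self W'.toRepresentation
  rw [character_eq_add_of_isCompl hc] at hρ
  simp only [Pi.add_apply, add_mul, mul_add, Finset.sum_add_distrib,
    card_inv_mul_sum_char_mul_char_eq_finrank] at hρ
  norm_cast at hρ
  omega

theorem isIrreducible_of_simple {G : Type} [Group G] [Finite G] (V : FDRep ℂ G)
    [CategoryTheory.Simple V] : IsIrreducible V.ρ := by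
  classical
  have := Fintype.ofFinite G
  have := invertibleOfNonzero (Nat.cast_ne_zero.2 Nat.card_pos.ne' : (Nat.card G : ℂ) ≠ 0)
  have hV := FDRep.char_orthonormal V V
  rw [if_pos ⟨CategoryTheory.Iso.refl V⟩] at hV
  exact isIrreducible_of_char_norm_eq_one V.ρ hV

theorem isVirtualChar_character {G V : Type} [Group G] [Finite G] [AddCommGroup V]
    [Module ℂ V] [FiniteDimensional ℂ V] (ρ : Representation ℂ G V) :
    IsVirtualChar G ρ.character := by
  induction h : Module.finrank ℂ V using Nat.strong_induction_on generalizing V with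
  | _ n ih =>
  subst h
  have : NeZero (Nat.card G : ℂ) := ⟨Nat.cast_ne_zero.2 Nat.card_pos.ne'⟩
  by_cases hi : IsIrreducible ρ
  · exact Submodule.subset_span (IsIrrChar.of_isIrreducible ρ)
  rcases subsingleton_or_nontrivial V with hs | hnt
  · have h0 : ρ.character = 0 := funext fun g => by
      rw [Representation.character, Subsingleton.elim (ρ g) 0, map_zero, Pi.zero_apply]
    rw [h0]
    exact Submodule.zero_mem _
  have : Nontrivial (Subrepresentation ρ) :=
    ⟨⊥, ⊤, fun h => bot_ne_top (congrArg Subrepresentation.toSubmodule h)⟩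
  obtain ⟨W, hbot, htop⟩ : ∃ W : Subrepresentation ρ, W ≠ ⊥ ∧ W ≠ ⊤ := by
    by_contra! hW
    exact hi ⟨fun W => or_iff_not_imp_left.2 (hW W)⟩
  obtain ⟨W', hc⟩ := exists_isCompl W
  have htop' : W' ≠ ⊤ := fun h => hbot (by simpa [h] using hc.disjoint)
  have hlt (U : Subrepresentation ρ) (hU : U ≠ ⊤) :
      Module.finrank ℂ U.toSubmodule < Module.finrank ℂ V :=
    Submodule.finrank_lt fun h => hU (Subrepresentation.toSubmodule_injective h)
  rw [character_eq_add_of_isCompl hc]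
  exact Submodule.add_mem _ (ih _ (hlt W htop) _ rfl) (ih _ (hlt W' htop') _ rfl)

theorem Submodule.eq_top_of_irreducible {k G V : Type*} [Field k] [Group G] [AddCommGroup V]
    [Module k V] (ρ : Representation k G V) [IsIrreducible ρ] {v : V} (hv : v ≠ 0)
    (S : Submodule k V) (hvS : v ∈ S) (hS : ∀ g, ∀ w ∈ S, ρ g w ∈ S) : S = ⊤ := by
  rcases eq_bot_or_eq_top (⟨S, fun g w hw => hS g w hw⟩ : Subrepresentation ρ) with h | h
  · have h' : S = ⊥ := congrArg Subrepresentation.toSubmodule h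
    exact absurd (by simpa [h'] using hvS) hv
  · exact congrArg Subrepresentation.toSubmodule h

theorem exists_conj_eq_zpow {G : Type*} [Group G] {N : Subgroup G} [N.Normal] [IsCyclic N]
    {n : G} (hn : n ∈ N) (g : G) : ∃ i : ℤ, g * n * g⁻¹ = n ^ i := by
  obtain ⟨i, hi⟩ := MonoidHom.map_cyclic
    ((MulAut.conjNormal g : MulAut N).toMonoidHom)
  exact ⟨i, by simpa using congrArg Subtype.val (hi ⟨n, hn⟩)⟩

theorem map_zpow_apply_of_apply_eq_smul {k G V : Type*} [Field k] [Group G] [AddCommGroup V]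
    [Module k V] (ρ : Representation k G V) {v : V} (hv : v ≠ 0) {g : G} {c : k}
    (h : ρ g v = c • v) (i : ℤ) : ρ (g ^ i) v = c ^ i • v := by
  have hc : c ≠ 0 := by
    rintro rfl
    exact hv (by simpa using congrArg (ρ g⁻¹) h)
  have hinv : ρ g⁻¹ v = c⁻¹ • v := by
    rw [eq_inv_smul_iff₀ hc, ← map_smul, ← h, inv_self_apply]
  have hnat {g : G} {c : k} (h : ρ g v = c • v) (n : ℕ) : ρ (g ^ n) v = c ^ n • v := by
    induction n with
    | zero => simp
    | succ n ih => rw [pow_succ, map_mul, Module.End.mul_apply, h, map_smul, ih, smul_smul, pow_succ']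
  obtain ⟨n, rfl | rfl⟩ := i.eq_nat_or_neg
  · simpa using hnat h n
  · simpa using hnat hinv n

theorem eq_one_of_apply_eq_self {k G V : Type*} [Field k] [Group G] [AddCommGroup V]
    [Module k V] (ρ : Representation k G V) [IsIrreducible ρ] {N : Subgroup G} [N.Normal]
    [IsCyclic N] {n : G} (hn : n ∈ N) {v : V} (hv : v ≠ 0) (h : ρ n v = v) : ρ n = 1 := by
  have : LinearMap.eqLocus (ρ n) LinearMap.id = ⊤ := by
    refine Submodule.eq_top_of_irreducible ρ hv _ h fun g w (hw : ρ n w = w) => ?_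
    by_cases hw0 : w = 0
    · simp [hw0]
    obtain ⟨i, hi⟩ := exists_conj_eq_zpow hn g⁻¹
    have h1 : ρ (n ^ i) w = w := by
      simpa using map_zpow_apply_of_apply_eq_smul ρ hw0 (c := 1) (by simpa using hw) i
    have h2 : n * g = g * n ^ i := by rw [← hi]; group
    change ρ n (ρ g w) = ρ g w
    rw [← Module.End.mul_apply, ← map_mul, h2, map_mul, Module.End.mul_apply, h1]
  ext w
  have : w ∈ LinearMap.eqLocus (ρ n) LinearMap.id := this ▸ Submodule.mem_top
  exact this

/-- The elements of `G` whose action commutes with that of `a`. -/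
def commutingSubgroup {k G V : Type*} [Field k] [Group G] [AddCommGroup V] [Module k V]
    (ρ : Representation k G V) (a : G) : Subgroup G where
  carrier := {g | ρ (g * a) = ρ (a * g)}
  one_mem' := by simp
  mul_mem' {x y} hx hy := by
    simp only [Set.mem_ofPred_eq, map_mul] at *
    rw [mul_assoc, hy, ← mul_assoc, hx, mul_assoc]
  inv_mem' {x} hx := by
    have h1 : x⁻¹ * a = x⁻¹ * (a * x) * x⁻¹ := by group
    have h2 : a * x⁻¹ = x⁻¹ * (x * a) * x⁻¹ := by group
    simp only [Set.mem_ofPred_eq] at *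
    rw [h1, h2, map_mul, map_mul ρ x⁻¹, map_mul ρ _ x⁻¹, map_mul ρ x⁻¹, hx]

/-- A common eigenvector of two commuting endomorphisms. -/
theorem exists_common_eigenvector {k V : Type*} [Field k] [IsAlgClosed k] [AddCommGroup V]
    [Module k V] [FiniteDimensional k V] [Nontrivial V] {f g : Module.End k V}
    (h : Commute f g) : ∃ v ≠ 0, (∃ c : k, f v = c • v) ∧ ∃ c : k, g v = c • v := by
  obtain ⟨c, hc⟩ := Module.End.exists_eigenvalue f
  have hmap : Set.MapsTo g (f.eigenspace c) (f.eigenspace c) :=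
    Module.End.mapsTo_genEigenspace_of_comm h c 1
  have : Nontrivial (f.eigenspace c) := Submodule.nontrivial_iff_ne_bot.2 hc
  obtain ⟨d, hd⟩ := Module.End.exists_eigenvalue (g.restrict hmap)
  obtain ⟨w, hw⟩ := hd.exists_hasEigenvector
  refine ⟨w, by simpa using hw.2, ⟨c, Module.End.mem_eigenspace_iff.1 w.2⟩, d, ?_⟩
  exact congrArg Subtype.val hw.apply_eq_smul

theorem exists_eigenvector_commutingSubgroup {k G V : Type*} [Field k] [IsAlgClosed k] [Group G]
    [AddCommGroup V] [Module k V] [FiniteDimensional k V] [Nontrivial V]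
    (ρ : Representation k G V) [IsCyclic (Abelianization G)] {a : G}
    (ha : Subgroup.zpowers a = commutator G) :
    ∃ v ≠ 0, ∀ h ∈ commutingSubgroup ρ a, ∃ c : k, ρ h v = c • v := by
  obtain ⟨⟨_, b, hb, rfl⟩, hgen⟩ := IsCyclic.exists_generator
    (α := (commutingSubgroup ρ a).map (Abelianization.of))
  have hb' : ρ (b * a) = ρ (a * b) := hb
  rw [map_mul, map_mul] at hb'
  obtain ⟨v, hv, ⟨c, hc⟩, d, hd⟩ := exists_common_eigenvector (f := ρ a) (g := ρ b) hb'.symm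
  refine ⟨v, hv, fun h hh => ?_⟩
  obtain ⟨i, hi⟩ := hgen ⟨_, h, hh, rfl⟩
  have hi' : Abelianization.of (b ^ i) = Abelianization.of h := by
    simpa using congrArg Subtype.val hi
  have hmem : h * (b ^ i)⁻¹ ∈ Subgroup.zpowers a := by
    rw [ha, ← Abelianization.ker_of, MonoidHom.mem_ker, map_mul, map_inv, hi', mul_inv_cancel]
  obtain ⟨j, hj⟩ := hmem
  have hh' : h = a ^ j * b ^ i := by
    rw [show a ^ j = h * (b ^ i)⁻¹ from hj]; group
  refine ⟨d ^ i * c ^ j, ?_⟩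
  rw [hh', map_mul, Module.End.mul_apply, map_zpow_apply_of_apply_eq_smul ρ hv hd, map_smul,
    map_zpow_apply_of_apply_eq_smul ρ hv hc, smul_smul]

/-- An irreducible representation of a finite group of squarefree order is regular on some
subgroup. -/
theorem exists_subgroup_basis {G V : Type*} [Group G] [Finite G] [AddCommGroup V]
    [Module ℂ V] [FiniteDimensional ℂ V] (h : Squarefree (Nat.card G))
    (ρ : Representation ℂ G V) [IsIrreducible ρ] :
    ∃ (K : Subgroup G) (b : Module.Basis K ℂ V), ∀ x y : K, ρ x (b y) = b (x * y) := by
  have := IsZGroup.of_squarefree h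
  have := IsZGroup.isCyclic_commutator (G := G)
  obtain ⟨a, ha⟩ := (Subgroup.isCyclic_iff_exists_zpowers_eq_top (commutator G)).1 this
  have haN : a ∈ commutator G := ha ▸ Subgroup.mem_zpowers a
  have hnt : Nontrivial V := by
    by_contra hs
    rw [not_nontrivial_iff_subsingleton] at hs
    exact bot_ne_top (α := Subrepresentation ρ)
      (Subrepresentation.toSubmodule_injective (Subsingleton.elim _ _))
  obtain ⟨v, hv, hev⟩ := exists_eigenvector_commutingSubgroup ρ ha
  have hNH : commutator G ≤ commutingSubgroup ρ a := by
    rw [← ha, Subgroup.zpowers_le]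
    rfl
  have : (commutingSubgroup ρ a).Normal := Subgroup.Normal.of_commutator_le _ hNH
  have hcop : (Nat.card (commutingSubgroup ρ a)).Coprime (commutingSubgroup ρ a).index := by
    rw [← (commutingSubgroup ρ a).card_mul_index] at h
    exact (Nat.squarefree_mul_iff.1 h).1
  obtain ⟨K, hK⟩ := Subgroup.exists_right_complement'_of_coprime hcop
  choose! c hc using hev
  have hconj (g : G) : g⁻¹ * a * g ∈ commutator G := by
    simpa using (inferInstance : (commutator G).Normal).conj_mem a haN g⁻¹
  have heig (x : G) : ρ a (ρ x v) = c (x⁻¹ * a * x) • ρ x v := by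
    rw [← map_smul, ← hc _ (hNH (hconj x)), ← Module.End.mul_apply, ← Module.End.mul_apply,
      ← map_mul, ← map_mul]
    congr 2
    group
  have hinj : Function.Injective fun x : K => c ((x : G)⁻¹ * a * x) := by
    intro x y hxy
    have hx := hc _ (hNH (hconj x))
    have hy := hc _ (hNH (hconj y))
    simp only at hxy
    rw [hxy, ← hy] at hx
    have hone : ρ (((y : G)⁻¹ * a * y)⁻¹ * ((x : G)⁻¹ * a * x)) = 1 := by
      refine eq_one_of_apply_eq_self ρ (mul_mem (inv_mem (hconj y)) (hconj x)) hv ?_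
      rw [map_mul, Module.End.mul_apply, hx, inv_self_apply]
    have hmem : (y : G) * (x : G)⁻¹ ∈ commutingSubgroup ρ a := by
      change ρ _ = ρ _
      have e : (y : G) * (x : G)⁻¹ * a = a * (y * (x : G)⁻¹) * (x *
          (((y : G)⁻¹ * a * y)⁻¹ * ((x : G)⁻¹ * a * x)) * (x : G)⁻¹) := by group
      rw [e, map_mul, map_mul ρ (_ * _) (x : G)⁻¹, map_mul ρ (x : G), hone, mul_one, ← map_mul,
        mul_inv_cancel, map_one, mul_one]
    have := (Subgroup.disjoint_def.1 hK.disjoint) hmem (mul_mem y.2 (inv_mem x.2))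
    exact (Subtype.ext (mul_inv_eq_one.1 this)).symm
  have hne (x : G) : ρ x v ≠ 0 := fun h0 => hv (by simpa using congrArg (ρ x⁻¹) h0)
  have hli : LinearIndependent ℂ fun x : K => ρ x v :=
    Module.End.eigenvectors_linearIndependent' (ρ a) _ hinj _ fun x =>
      ⟨Module.End.mem_eigenspace_iff.2 (heig x), hne x⟩
  have hmem (g : G) : ρ g v ∈ Submodule.span ℂ (Set.range fun x : K => ρ x v) := by
    obtain ⟨⟨x, y⟩, hxy⟩ := hK.symm.2 g
    have hxy : (x : G) * y = g := hxy
    rw [← hxy, map_mul, Module.End.mul_apply, hc _ y.2, map_smul]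
    exact Submodule.smul_mem _ _ (Submodule.subset_span ⟨x, rfl⟩)
  have hsp : ⊤ ≤ Submodule.span ℂ (Set.range fun x : K => ρ x v) := by
    refine (Submodule.eq_top_of_irreducible ρ hv _ (by simpa using hmem 1) fun g w hw => ?_).ge
    revert w
    refine (Submodule.span_le (p := (Submodule.span ℂ _).comap (ρ g))).2 ?_
    rintro _ ⟨x, rfl⟩
    have := hmem (g * x)
    rwa [map_mul] at this
  exact ⟨K, .mk hli hsp, fun x y => by simp⟩

/-- A finite group of squarefree order is of Knutson type. -/
theorem squarefree_order_isKnutsonType (G : Type) [Group G] [Finite G]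
    (h : Squarefree (Nat.card G)) :
    IsKnutsonType G := by
  rintro _ ⟨V, hV, rfl⟩
  have := isIrreducible_of_simple V
  obtain ⟨K, b, hb⟩ := exists_subgroup_basis h V.ρ
  let σ := ofMulAction ℂ G (G ⧸ K)
  let e : Module.Basis (G ⧸ K) ℂ (MonoidAlgebra ℂ (G ⧸ K)) :=
    .ofRepr (MonoidAlgebra.coeffLinearEquiv ℂ)
  have he (g : G) (q : G ⧸ K) : σ g (e q) = e (g • q) := ofMulAction_single g q 1
  refine ⟨σ.character, isVirtualChar_character σ, ?_⟩
  ext g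
  rw [Pi.mul_apply, regChar]
  split_ifs with hg
  · rw [hg, FDRep.char_one, Representation.char_one, Module.finrank_eq_nat_card_basis b,
      Module.finrank_eq_nat_card_basis e, ← Nat.cast_mul, ← Subgroup.index_eq_card,
      K.card_mul_index]
  by_cases hfix : ∃ q : G ⧸ K, g • q = q
  · obtain ⟨q, hq⟩ := hfix
    induction q using QuotientGroup.induction_on with | H x => ?_
    have hk : x⁻¹ * g * x ∈ K := by
      rw [mul_assoc]
      exact QuotientGroup.eq.1 hq.symm
    have h0 : V.character (x⁻¹ * g * x) = 0 := by
      refine trace_eq_zero_of_basis_permuted b _ (fun y => ⟨_, hk⟩ * y) (fun y hy => hg ?_)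
        fun y => hb ⟨_, hk⟩ y
      have h1 : x⁻¹ * g * x = 1 := congrArg Subtype.val (mul_eq_right.1 hy)
      rwa [mul_assoc, inv_mul_eq_one, eq_comm, mul_eq_right] at h1
    have := V.char_conj g x⁻¹
    rw [inv_inv, h0] at this
    rw [← this, zero_mul]
  · push Not at hfix
    have h0 : σ.character g = 0 := trace_eq_zero_of_basis_permuted e _ _ hfix (he g)
    rw [h0, mul_zero]
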